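/- arXiv:2505.07761 — 4 statements merged into one kernel-verified Lean document; each statement's English description precedes it below -/
import Mathlib

section
/- Let P be a probability measure on a measurable space Ω and f : Ω → ℝ a bounded measurable function. Then log(∫ exp(f) dP) is the supremum, over all probability measures Q on Ω with Q ≪ P and KL(Q‖P) < ∞, of ∫ f dQ − KL(Q‖P). -/
open MeasureTheory Real
open scoped Classical

/-- Kullback–Leibler divergence of `μ` with respect to `ν`, defined as in Mathlib's
`InformationTheory.klDiv`. -/
noncomputable def klDiv {Ω : Type*} [MeasurableSpace Ω] (μ ν : Measure Ω) : EReal :=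
  if μ ≪ ν ∧ Integrable (llr μ ν) μ then ((∫ ω, llr μ ν ω ∂μ : ℝ) : EReal) else ⊤

lemma klDiv_of_ac_of_integrable {Ω : Type*} [MeasurableSpace Ω] {μ ν : Measure Ω}
    (hμν : μ ≪ ν) (h_int : Integrable (llr μ ν) μ) :
    klDiv μ ν = ((∫ ω, llr μ ν ω ∂μ : ℝ) : EReal) :=
  if_pos ⟨hμν, h_int⟩

lemma integrable_llr_of_klDiv_lt_top {Ω : Type*} [MeasurableSpace Ω] {μ ν : Measure Ω}
    (h : klDiv μ ν < ⊤) : Integrable (llr μ ν) μ := by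
  by_contra h_int
  exact h.ne (if_neg fun h' => h_int h'.2)

/-- The variational inequality: the entropy-penalized expectation is at most `log ∫ exp f dP`. -/
lemma integral_sub_integral_llr_le_log_integral_exp {Ω : Type*} [MeasurableSpace Ω]
    {P Q : Measure Ω} [IsProbabilityMeasure P] [IsProbabilityMeasure Q] {f : Ω → ℝ}
    (hQP : Q ≪ P) (h_int : Integrable (llr Q P) Q) (hfQ : Integrable f Q)
    (hfP : Integrable (fun ω => exp (f ω)) P) :
    ∫ ω, f ω ∂Q - ∫ ω, llr Q P ω ∂Q ≤ log (∫ ω, exp (f ω) ∂P) := by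
  have := isProbabilityMeasure_tilted hfP
  have h_nonneg := InformationTheory.integral_llr_add_sub_measure_univ_nonneg
    (hQP.trans (absolutelyContinuous_tilted hfP)) (integrable_llr_tilted_right hQP hfQ h_int hfP)
  rw [integral_llr_tilted_right hQP hfQ hfP h_int] at h_nonneg
  simp only [probReal_univ] at h_nonneg
  linarith

/-- The log-likelihood ratio of the Gibbs measure `P.tilted f` with respect to `P`. -/
lemma llr_tilted_self {Ω : Type*} [MeasurableSpace Ω] {P : Measure Ω} [SigmaFinite P] {f : Ω → ℝ}
    (hfP : Integrable (fun ω => exp (f ω)) P) :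
    llr (P.tilted f) P =ᵐ[P.tilted f] fun ω => f ω - log (∫ z, exp (f z) ∂P) :=
  (tilted_absolutelyContinuous P f).ae_le (log_rnDeriv_tilted_left_self hfP)

/-- Donsker–Varadhan variational formula: for a bounded measurable `f`,
`log ∫ exp f dP` is the supremum over probability measures `Q ≪ P` with finite
Kullback–Leibler divergence of `∫ f dQ - KL(Q‖P)`. -/
theorem log_integral_exp_isLUB_entropy_penalized
    {Ω : Type*} [MeasurableSpace Ω] (P : Measure Ω) [IsProbabilityMeasure P]
    (f : Ω → ℝ) (hfmeas : Measurable f) (C : ℝ) (hfbdd : ∀ ω, |f ω| ≤ C) :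
    IsLUB {r : ℝ | ∃ Q : Measure Ω, IsProbabilityMeasure Q ∧ Q ≪ P ∧ klDiv Q P < ⊤ ∧
        r = ∫ ω, f ω ∂Q - (klDiv Q P).toReal}
      (Real.log (∫ ω, Real.exp (f ω) ∂P)) := by
  have hf_int (Q : Measure Ω) [IsProbabilityMeasure Q] : Integrable f Q :=
    .of_bound hfmeas.aestronglyMeasurable C (ae_of_all _ hfbdd)
  have hfP : Integrable (fun ω => exp (f ω)) P :=
    .of_bound hfmeas.exp.aestronglyMeasurable (exp C) <| ae_of_all _ fun ω => by
      simpa using (le_abs_self _).trans (hfbdd ω)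
  constructor
  · rintro r ⟨Q, hQ, hQP, hKL, rfl⟩
    have h_int := integrable_llr_of_klDiv_lt_top hKL
    rw [klDiv_of_ac_of_integrable hQP h_int, EReal.toReal_coe]
    exact integral_sub_integral_llr_le_log_integral_exp hQP h_int (hf_int Q) hfP
  · intro b hb
    have hQ := isProbabilityMeasure_tilted hfP
    have hQP := tilted_absolutelyContinuous P f
    have h_llr := llr_tilted_self hfP
    have h_int : Integrable (llr (P.tilted f) P) (P.tilted f) :=
      ((hf_int _).sub (integrable_const _)).congr h_llr.symm
    have hKL := klDiv_of_ac_of_integrable hQP h_int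
    refine hb ⟨P.tilted f, hQ, hQP, hKL ▸ EReal.coe_lt_top _, ?_⟩
    rw [hKL, EReal.toReal_coe, integral_congr_ae h_llr,
      integral_sub (hf_int _) (integrable_const _)]
    simp
end

section
/- Let P be a probability measure on a measurable space Ω and f : Ω → ℝ a bounded measurable function. Define the Gibbs measure Q* as the measure with density exp(f)/(∫ exp(f) dP) with respect to P (i.e. Q* = P.withDensity of this function). Then Q* is a probability measure, Q* ≪ P, KL(Q*‖P) < ∞, and ∫ f dQ* − KL(Q*‖P) = log(∫ exp(f) dP). In particular the supremum of ∫ f dQ − KL(Q‖P) over probability measures Q ≪ P is attained at Q*. -/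
open MeasureTheory Real
open scoped Classical

theorem integrable_exp_of_abs_le {Ω : Type*} [MeasurableSpace Ω] (P : Measure Ω)
    [IsFiniteMeasure P] {f : Ω → ℝ} (hf : Measurable f) {C : ℝ} (hC : ∀ ω, |f ω| ≤ C) :
    Integrable (fun ω => Real.exp (f ω)) P :=
  .of_bound hf.exp.aestronglyMeasurable (Real.exp C) <| .of_forall fun ω => by
    rw [Real.norm_eq_abs, Real.abs_exp]
    exact Real.exp_le_exp.mpr ((le_abs_self _).trans (hC ω))

/-- The divergence of an exponentially tilted measure from the original one. -/
theorem klDiv_tilted_self {Ω : Type*} [MeasurableSpace Ω] {P : Measure Ω}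
    [IsProbabilityMeasure P] {f : Ω → ℝ} (hexp : Integrable (fun ω => Real.exp (f ω)) P)
    (hf : Integrable f (P.tilted f)) :
    klDiv (P.tilted f) P =
      ((∫ ω, f ω ∂(P.tilted f) - Real.log (∫ ω, Real.exp (f ω) ∂P) : ℝ) : EReal) := by
  have hac := tilted_absolutelyContinuous P f
  have := isProbabilityMeasure_tilted hexp
  have hllr : llr (P.tilted f) P =ᵐ[P.tilted f]
      fun ω => f ω - Real.log (∫ ω, Real.exp (f ω) ∂P) :=
    hac.ae_le (log_rnDeriv_tilted_left_self hexp)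
  have hint : Integrable (llr (P.tilted f) P) (P.tilted f) :=
    (integrable_congr hllr).mpr (hf.sub (integrable_const _))
  rw [klDiv, if_pos ⟨hac, hint⟩, integral_congr_ae hllr, integral_sub hf (integrable_const _)]
  simp

/-- The easy half of the Gibbs (Donsker–Varadhan) variational principle. -/
theorem integral_sub_klDiv_le_log_integral_exp {Ω : Type*} [MeasurableSpace Ω]
    {P Q : Measure Ω} [IsProbabilityMeasure P] [IsProbabilityMeasure Q] {f : Ω → ℝ}
    (hQP : Q ≪ P) (hf : Integrable f Q) (hexp : Integrable (fun ω => Real.exp (f ω)) P) :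
    ((∫ ω, f ω ∂Q : ℝ) : EReal) - klDiv Q P ≤
      ((Real.log (∫ ω, Real.exp (f ω) ∂P) : ℝ) : EReal) := by
  by_cases hint : Integrable (llr Q P) Q
  · have := isProbabilityMeasure_tilted hexp
    have hnonneg := InformationTheory.integral_llr_add_sub_measure_univ_nonneg
      (hQP.trans (absolutelyContinuous_tilted hexp))
      (integrable_llr_tilted_right hQP hf hint hexp)
    rw [integral_llr_tilted_right hQP hf hexp hint, probReal_univ, probReal_univ] at hnonneg
    rw [klDiv, if_pos ⟨hQP, hint⟩, ← EReal.coe_sub, EReal.coe_le_coe_iff]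
    linarith
  · rw [klDiv, if_neg (fun h => hint h.2), EReal.sub_top]
    exact bot_le

/-- The Gibbs measure `Q* = (exp f / ∫ exp f dP) · P` is a probability measure absolutely
continuous with respect to `P`, has finite Kullback–Leibler divergence, and attains the
supremum `log ∫ exp f dP` in the entropy-penalized variational formula. -/
theorem gibbs_measure_attains_entropy_penalized_sup
    {Ω : Type*} [MeasurableSpace Ω] (P : Measure Ω) [IsProbabilityMeasure P]
    (f : Ω → ℝ) (hfmeas : Measurable f) (C : ℝ) (hfbdd : ∀ ω, |f ω| ≤ C)
    (Qstar : Measure Ω)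
    (hQstar : Qstar =
      P.withDensity (fun ω => ENNReal.ofReal (Real.exp (f ω) / ∫ ω', Real.exp (f ω') ∂P))) :
    IsProbabilityMeasure Qstar ∧ Qstar ≪ P ∧ klDiv Qstar P < ⊤ ∧
      ∫ ω, f ω ∂Qstar - (klDiv Qstar P).toReal = Real.log (∫ ω, Real.exp (f ω) ∂P) ∧
      ∀ Q : Measure Ω, IsProbabilityMeasure Q → Q ≪ P →
        ((∫ ω, f ω ∂Q : ℝ) : EReal) - klDiv Q P ≤
          ((∫ ω, f ω ∂Qstar - (klDiv Qstar P).toReal : ℝ) : EReal) := by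
  have hexp := integrable_exp_of_abs_le P hfmeas hfbdd
  have hac : Qstar ≪ P := hQstar ▸ withDensity_absolutelyContinuous _ _
  obtain rfl : Qstar = P.tilted f := hQstar
  have hprob : IsProbabilityMeasure (P.tilted f) := isProbabilityMeasure_tilted hexp
  have hf (Q : Measure Ω) [IsProbabilityMeasure Q] : Integrable f Q :=
    .of_bound hfmeas.aestronglyMeasurable C (.of_forall hfbdd)
  have hkl := klDiv_tilted_self hexp (hf (P.tilted f))
  have hval : ∫ ω, f ω ∂(P.tilted f) - (klDiv (P.tilted f) P).toReal
      = Real.log (∫ ω, Real.exp (f ω) ∂P) := by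
    rw [hkl, EReal.toReal_coe, sub_sub_cancel]
  refine ⟨hprob, hac, hkl ▸ EReal.coe_lt_top _, hval, fun Q hQ hQP => ?_⟩
  rw [hval]
  exact integral_sub_klDiv_le_log_integral_exp hQP (hf Q) hexp
end

section
/- Let s > 0, m ∈ ℝ, γ > 0 and z ∈ ℝ, and let P = gaussianReal m s be the Gaussian measure on ℝ with mean m and variance s. Then (γs/2)·z² = (1/γ)·log(∫ exp(γ·z·(x − m)) dP(x)), and for every probability measure Q on ℝ with Q ≪ P, with x ↦ x Q-integrable and KL(Q‖P) < ∞, one has (γs/2)·z² ≥ z·(∫ x dQ(x) − m) − (1/γ)·KL(Q‖P). -/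
open MeasureTheory Real ProbabilityTheory
open scoped Classical

/-- Gibbs variational inequality: the log-Laplace transform of `f` under `ν` dominates the mean of
`f` under `μ` penalized by the relative entropy of `μ` with respect to `ν`. -/
theorem integral_sub_integral_llr_le_log_integral_exp_s3 {Ω : Type*} [MeasurableSpace Ω]
    {μ ν : Measure Ω} [IsProbabilityMeasure μ] [IsProbabilityMeasure ν] {f : Ω → ℝ}
    (hμν : μ ≪ ν) (hf : Integrable f μ) (hexp : Integrable (fun x => Real.exp (f x)) ν)
    (hllr : Integrable (llr μ ν) μ) :
    ∫ x, f x ∂μ - ∫ x, llr μ ν x ∂μ ≤ Real.log (∫ x, Real.exp (f x) ∂ν) := by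
  have := isProbabilityMeasure_tilted hexp
  have hnonneg := InformationTheory.integral_llr_add_sub_measure_univ_nonneg
    (hμν.trans (absolutelyContinuous_tilted hexp))
    (integrable_llr_tilted_right hμν hf hllr hexp)
  rw [integral_llr_tilted_right hμν hf hexp hllr] at hnonneg
  simp only [probReal_univ] at hnonneg
  linarith

theorem integrable_exp_mul_sub_gaussianReal (m t : ℝ) (v : NNReal) :
    Integrable (fun x => Real.exp (t * (x - m))) (gaussianReal m v) := by
  have h := (integrable_exp_mul_gaussianReal (μ := m) (v := v) t).mul_const (Real.exp (-(t * m)))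
  refine h.congr (.of_forall fun x => ?_)
  simp only [← Real.exp_add]
  ring_nf

theorem integral_exp_mul_sub_gaussianReal (m t : ℝ) (v : NNReal) :
    ∫ x, Real.exp (t * (x - m)) ∂(gaussianReal m v) = Real.exp (v * t ^ 2 / 2) := by
  have h : ∫ x, Real.exp (t * x) ∂(gaussianReal m v) = Real.exp (m * t + v * t ^ 2 / 2) :=
    congrFun mgf_id_gaussianReal t
  simp only [mul_sub, Real.exp_sub, integral_div, h]
  rw [← Real.exp_sub]
  ring_nf

/-- The quadratic ambiguity adjustment `(γ s / 2) z²` equals the log-Laplace transform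
`(1/γ) log ∫ exp (γ z (x - m)) dP` of the Gaussian `P = gaussianReal m s`, and dominates the
entropy-penalized drift distortion `z (∫ x dQ - m) - (1/γ) KL(Q‖P)` for every prior `Q ≪ P`
with integrable mean and finite Kullback–Leibler divergence. -/
theorem gaussian_quadratic_ambiguity_adjustment
    (s m γ z : ℝ) (hs : 0 < s) (hγ : 0 < γ) :
    (γ * s / 2) * z ^ 2 =
      (1 / γ) * Real.log (∫ x, Real.exp (γ * z * (x - m)) ∂(gaussianReal m s.toNNReal)) ∧
    ∀ Q : Measure ℝ, IsProbabilityMeasure Q → Q ≪ gaussianReal m s.toNNReal →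
      Integrable (fun x => x) Q → klDiv Q (gaussianReal m s.toNNReal) < ⊤ →
      z * ((∫ x, x ∂Q) - m) - (1 / γ) * (klDiv Q (gaussianReal m s.toNNReal)).toReal ≤
        (γ * s / 2) * z ^ 2 := by
  have hlog : Real.log (∫ x, Real.exp (γ * z * (x - m)) ∂(gaussianReal m s.toNNReal)) =
      s * (γ * z) ^ 2 / 2 := by
    rw [integral_exp_mul_sub_gaussianReal, Real.log_exp, Real.coe_toNNReal s hs.le]
  refine ⟨by rw [hlog]; field_simp, fun Q hQ hac hint hkl => ?_⟩
  have hllr : Integrable (llr Q (gaussianReal m s.toNNReal)) Q := by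
    by_contra hllr
    simp [klDiv, hllr] at hkl
  rw [klDiv, if_pos ⟨hac, hllr⟩, EReal.toReal_coe]
  have hgibbs := integral_sub_integral_llr_le_log_integral_exp_s3 hac
    ((hint.sub (integrable_const m)).const_mul (γ * z))
    (integrable_exp_mul_sub_gaussianReal m (γ * z) s.toNNReal) hllr
  simp only [Pi.sub_apply] at hgibbs
  rw [hlog, integral_const_mul, integral_sub hint (integrable_const m), integral_const,
    probReal_univ, one_smul] at hgibbs
  refine le_of_mul_le_mul_left ?_ hγ
  calc γ * (z * ((∫ x, x ∂Q) - m) - 1 / γ * ∫ x, llr Q (gaussianReal m s.toNNReal) x ∂Q)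
      = γ * z * ((∫ x, x ∂Q) - m) - ∫ x, llr Q (gaussianReal m s.toNNReal) x ∂Q := by
        field_simp
    _ ≤ s * (γ * z) ^ 2 / 2 := hgibbs
    _ = γ * (γ * s / 2 * z ^ 2) := by ring
end

section
/- Let s > 0, m ∈ ℝ, γ > 0 and z ∈ ℝ. Let P = gaussianReal m s and Q* = gaussianReal (m + γ·z·s) s. Then Q* ≪ P, KL(Q*‖P) = γ²·z²·s/2, and equality holds in the entropy-penalized bound: (γs/2)·z² = z·(∫ x dQ*(x) − m) − (1/γ)·KL(Q*‖P). -/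
open MeasureTheory Real ProbabilityTheory
open scoped Classical

/-- The log-likelihood ratio of two Gaussian measures with the same variance is affine. -/
lemma llr_gaussianReal_same_variance (a b : ℝ) {v : NNReal} (hv : v ≠ 0) :
    llr (gaussianReal a v) (gaussianReal b v) =ᵐ[gaussianReal a v]
      fun x ↦ (a - b) / v * (x - (a + b) / 2) := by
  have hav := gaussianReal_absolutelyContinuous a hv
  have hab : gaussianReal a v ≪ gaussianReal b v :=
    hav.trans (gaussianReal_absolutelyContinuous' b hv)
  have hchain := Measure.rnDeriv_mul_rnDeriv (κ := volume) hab
  filter_upwards [hav hchain, hav (rnDeriv_gaussianReal a v), hav (rnDeriv_gaussianReal b v)]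
    with x hx ha hb
  have hv' : (v : ℝ) ≠ 0 := by exact_mod_cast hv
  have hpos := gaussianPDFReal_pos b v x hv
  simp only [Pi.mul_apply, ha, hb] at hx
  have hreal := congrArg ENNReal.toReal hx
  rw [ENNReal.toReal_mul, toReal_gaussianPDF, toReal_gaussianPDF, ← eq_div_iff hpos.ne'] at hreal
  rw [llr_def]
  simp only [hreal]
  have hratio : gaussianPDFReal a v x / gaussianPDFReal b v x =
      exp ((a - b) / v * (x - (a + b) / 2)) := by
    rw [div_eq_iff hpos.ne', gaussianPDFReal, gaussianPDFReal, mul_left_comm, ← exp_add]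
    congr 2
    field_simp
    ring
  rw [hratio, log_exp]

lemma integrable_id_gaussianReal (a : ℝ) (v : NNReal) :
    Integrable (fun x ↦ x) (gaussianReal a v) :=
  (memLp_id_gaussianReal 1).integrable le_rfl

/-- The Kullback–Leibler divergence of two Gaussian measures with the same variance. -/
lemma klDiv_gaussianReal_same_variance (a b : ℝ) {v : NNReal} (hv : v ≠ 0) :
    klDiv (gaussianReal a v) (gaussianReal b v) = (((a - b) ^ 2 / (2 * v) : ℝ) : EReal) := by
  have hab : gaussianReal a v ≪ gaussianReal b v :=
    (gaussianReal_absolutelyContinuous a hv).trans (gaussianReal_absolutelyContinuous' b hv)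
  have hllr := llr_gaussianReal_same_variance a b hv
  have hid := integrable_id_gaussianReal a v
  have hint : Integrable (llr (gaussianReal a v) (gaussianReal b v)) (gaussianReal a v) :=
    ((hid.sub (integrable_const _)).const_mul _).congr hllr.symm
  have hv' : (v : ℝ) ≠ 0 := by exact_mod_cast hv
  rw [klDiv, if_pos ⟨hab, hint⟩, integral_congr_ae hllr, integral_const_mul,
    integral_sub hid (integrable_const _), integral_id_gaussianReal, integral_const]
  congr 1
  simp only [probReal_univ, one_smul]
  field_simp
  ring

/-- Equality case of the entropy-penalized bound: the tilted Gaussian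
`Q* = gaussianReal (m + γ z s) s` is absolutely continuous with respect to
`P = gaussianReal m s`, has `KL(Q*‖P) = γ² z² s / 2`, and attains equality
`(γ s / 2) z² = z (∫ x dQ* - m) - (1/γ) KL(Q*‖P)`. -/
theorem tilted_gaussian_attains_equality
    (s m γ z : ℝ) (hs : 0 < s) (hγ : 0 < γ) :
    gaussianReal (m + γ * z * s) s.toNNReal ≪ gaussianReal m s.toNNReal ∧
    klDiv (gaussianReal (m + γ * z * s) s.toNNReal) (gaussianReal m s.toNNReal) =
      ((γ ^ 2 * z ^ 2 * s / 2 : ℝ) : EReal) ∧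
    (γ * s / 2) * z ^ 2 =
      z * ((∫ x, x ∂(gaussianReal (m + γ * z * s) s.toNNReal)) - m) -
        (1 / γ) *
          (klDiv (gaussianReal (m + γ * z * s) s.toNNReal) (gaussianReal m s.toNNReal)).toReal := by
  have hv : s.toNNReal ≠ 0 := (Real.toNNReal_pos.mpr hs).ne'
  have hkl : klDiv (gaussianReal (m + γ * z * s) s.toNNReal) (gaussianReal m s.toNNReal) =
      ((γ ^ 2 * z ^ 2 * s / 2 : ℝ) : EReal) := by
    rw [klDiv_gaussianReal_same_variance _ _ hv, Real.coe_toNNReal _ hs.le]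
    congr 1
    field_simp
    ring
  refine ⟨(gaussianReal_absolutelyContinuous _ hv).trans
    (gaussianReal_absolutelyContinuous' _ hv), hkl, ?_⟩
  rw [hkl, EReal.toReal_coe, integral_id_gaussianReal]
  field_simp
  ring
end
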